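/- The map 𝔊 : 𝔜 → 𝔛 defined by 𝔊(λ,x,y) = (λ,x) is a homeomorphism from 𝔜 onto 𝔛, with inverse given by (λ,x) ↦ (λ, x, φ(λ, x(·), x'(·))); moreover 𝔊 respects triviality: (λ,x,y) ∈ 𝔜 is a trivial T-triple (i.e. λ = 0 and (x,y) is constant) if and only if (λ,x) is a trivial T-forced pair (i.e. λ = 0 and x is constant). -/

import Mathlib

open Set MeasureTheory intervalIntegral BoundedContinuousFunction

/-- `f : ℝ × U × ℝⁿ × [0,∞) → ℝⁿ` is a `T`-periodic Carathéodory map. -/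
def TPeriodicCaratheodory (n : ℕ) (U : Set (EuclideanSpace ℝ (Fin n))) (T : ℝ)
    (f : ℝ → EuclideanSpace ℝ (Fin n) → EuclideanSpace ℝ (Fin n) → ℝ →
      EuclideanSpace ℝ (Fin n)) : Prop :=
  (∀ p ∈ U, ∀ q : EuclideanSpace ℝ (Fin n), ∀ lam ∈ Set.Ici (0:ℝ),
      ∀ᵐ t : ℝ, f (t + T) p q lam = f t p q lam) ∧
  (∀ p ∈ U, ∀ q : EuclideanSpace ℝ (Fin n), ∀ lam ∈ Set.Ici (0:ℝ),
      Measurable fun t : ℝ => f t p q lam) ∧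
  (∀ᵐ t : ℝ, ContinuousOn
      (fun z : EuclideanSpace ℝ (Fin n) × EuclideanSpace ℝ (Fin n) × ℝ =>
        f t z.1 z.2.1 z.2.2)
      (U ×ˢ Set.univ ×ˢ Set.Ici 0)) ∧
  (∀ K : Set (EuclideanSpace ℝ (Fin n) × EuclideanSpace ℝ (Fin n) × ℝ),
      K ⊆ U ×ˢ Set.univ ×ˢ Set.Ici 0 → IsCompact K →
      ∃ σ : ℝ → ℝ, (∀ t, 0 ≤ σ t) ∧ (∀ t, σ (t + T) = σ t) ∧
        MeasureTheory.LocallyIntegrable σ ∧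
        ∀ᵐ t : ℝ, ∀ z ∈ K, ‖f t z.1 z.2.1 z.2.2‖ ≤ σ t)

/-- The set `Y` of `T`-triples `(λ, x, y)` of the system
`x' = ψ(λ,x,y)`, `y' = g(x,ψ(λ,x,y)) + λ f(t,x,ψ(λ,x,y),λ)`, as a subset of
`ℝ × (ℝ →ᵇ ℝⁿ) × (ℝ →ᵇ ℝⁿ)` (the sup-metric encodes the `C⁰` topology on `[0,T]`,
by `T`-periodicity). -/
def TripleSet (n : ℕ) (U : Set (EuclideanSpace ℝ (Fin n)))
    (ψ : ℝ → EuclideanSpace ℝ (Fin n) → EuclideanSpace ℝ (Fin n) →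
      EuclideanSpace ℝ (Fin n))
    (g : EuclideanSpace ℝ (Fin n) → EuclideanSpace ℝ (Fin n) →
      EuclideanSpace ℝ (Fin n))
    (T : ℝ)
    (f : ℝ → EuclideanSpace ℝ (Fin n) → EuclideanSpace ℝ (Fin n) → ℝ →
      EuclideanSpace ℝ (Fin n)) :
    Set (ℝ × (ℝ →ᵇ EuclideanSpace ℝ (Fin n)) × (ℝ →ᵇ EuclideanSpace ℝ (Fin n))) :=
  {z | 0 ≤ z.1 ∧ (∀ t : ℝ, z.2.1 t ∈ U) ∧
    (∀ t : ℝ, z.2.1 (t + T) = z.2.1 t) ∧ (∀ t : ℝ, z.2.2 (t + T) = z.2.2 t) ∧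
    (∀ t : ℝ, z.2.1 t = z.2.1 0 + ∫ s in (0:ℝ)..t, ψ z.1 (z.2.1 s) (z.2.2 s)) ∧
    (∀ t : ℝ, z.2.2 t = z.2.2 0 +
      ∫ s in (0:ℝ)..t, (g (z.2.1 s) (ψ z.1 (z.2.1 s) (z.2.2 s)) +
        z.1 • f s (z.2.1 s) (ψ z.1 (z.2.1 s) (z.2.2 s)) z.1))}

/-- The set `X` of `T`-forced pairs of `[φ(λ,x,x')]' = g(x,x') + λ f(t,x,x',λ)`, encoded as triples
`(λ, x, x')` in `ℝ × (ℝ →ᵇ ℝⁿ) × (ℝ →ᵇ ℝⁿ)` where `x'` is the derivative of `x`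
(the sup-metrics on `x` and `x'` encode the `C¹` topology on `[0,T]`, by periodicity). -/
def ForcedSet (n : ℕ) (U : Set (EuclideanSpace ℝ (Fin n)))
    (φ : ℝ → EuclideanSpace ℝ (Fin n) → EuclideanSpace ℝ (Fin n) →
      EuclideanSpace ℝ (Fin n))
    (g : EuclideanSpace ℝ (Fin n) → EuclideanSpace ℝ (Fin n) →
      EuclideanSpace ℝ (Fin n))
    (T : ℝ)
    (f : ℝ → EuclideanSpace ℝ (Fin n) → EuclideanSpace ℝ (Fin n) → ℝ →
      EuclideanSpace ℝ (Fin n)) :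
    Set (ℝ × (ℝ →ᵇ EuclideanSpace ℝ (Fin n)) × (ℝ →ᵇ EuclideanSpace ℝ (Fin n))) :=
  {w | 0 ≤ w.1 ∧ (∀ t : ℝ, w.2.1 t ∈ U) ∧
    (∀ t : ℝ, w.2.1 (t + T) = w.2.1 t) ∧ (∀ t : ℝ, w.2.2 (t + T) = w.2.2 t) ∧
    (∀ t : ℝ, HasDerivAt w.2.1 (w.2.2 t) t) ∧
    (∀ t : ℝ, φ w.1 (w.2.1 t) (w.2.2 t) = φ w.1 (w.2.1 0) (w.2.2 0) +
      ∫ s in (0:ℝ)..t, (g (w.2.1 s) (w.2.2 s) +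
        w.1 • f s (w.2.1 s) (w.2.2 s) w.1))}

section Superposition

variable {E F : Type*} [PseudoMetricSpace E] [PseudoMetricSpace F]

/-- The curve `t ↦ (λ, x t, y t)` attached to a triple `(λ, x, y)`. -/
def tripleCurve (z : ℝ × (ℝ →ᵇ E) × (ℝ →ᵇ E)) (t : ℝ) : ℝ × E × E :=
  (z.1, z.2.1 t, z.2.2 t)

theorem continuous_tripleCurve (z : ℝ × (ℝ →ᵇ E) × (ℝ →ᵇ E)) :
    Continuous (tripleCurve z) :=
  continuous_const.prodMk (z.2.1.continuous.prodMk z.2.2.continuous)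

theorem dist_tripleCurve_le (z w : ℝ × (ℝ →ᵇ E) × (ℝ →ᵇ E)) (t : ℝ) :
    dist (tripleCurve z t) (tripleCurve w t) ≤ dist z w := by
  simp only [tripleCurve, Prod.dist_eq]
  exact max_le_max le_rfl (max_le_max (dist_coe_le_dist t) (dist_coe_le_dist t))

/-- The triples whose curve is `T`-periodic and stays in `S`. -/
def periodicTriples (S : Set (ℝ × E × E)) (T : ℝ) : Set (ℝ × (ℝ →ᵇ E) × (ℝ →ᵇ E)) :=
  {z | (∀ t, tripleCurve z t ∈ S) ∧ Function.Periodic (tripleCurve z) T}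

variable {S : Set (ℝ × E × E)} {T : ℝ}

theorem continuous_comp_tripleCurve {G : ℝ × E × E → F} (hG : ContinuousOn G S)
    {z : ℝ × (ℝ →ᵇ E) × (ℝ →ᵇ E)} (hz : z ∈ periodicTriples S T) :
    Continuous fun t => G (tripleCurve z t) :=
  hG.comp_continuous (continuous_tripleCurve z) hz.1

/-- The superposition operator `(λ, x, y) ↦ G (λ, x(·), y(·))` on periodic triples. -/
def superposition (hT : T ≠ 0) (G : ℝ × E × E → F) (hG : ContinuousOn G S)
    (z : periodicTriples S T) : ℝ →ᵇ F where
  toFun t := G (tripleCurve z.1 t)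
  continuous_toFun := continuous_comp_tripleCurve hG z.2
  map_bounded' := by
    have hper : Function.Periodic (fun t => G (tripleCurve z.1 t)) T := fun t =>
      congrArg G (z.2.2 t)
    obtain ⟨C, hC⟩ := Metric.isBounded_iff.1
      (hper.compact_of_continuous hT (continuous_comp_tripleCurve hG z.2)).isBounded
    exact ⟨C, fun s t => hC (mem_range_self s) (mem_range_self t)⟩

theorem superposition_apply (hT : T ≠ 0) {G : ℝ × E × E → F} (hG : ContinuousOn G S)
    (z : periodicTriples S T) (t : ℝ) :
    superposition hT G hG z t = G (tripleCurve z.1 t) :=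
  rfl

theorem continuous_superposition (hT : T ≠ 0) {G : ℝ × E × E → F} (hG : ContinuousOn G S) :
    Continuous (superposition hT G hG) := by
  rw [Metric.continuous_iff']
  intro z ε hε
  let c : periodicTriples S T → ℝ → S := fun w t => ⟨tripleCurve w.1 t, w.2.1 t⟩
  have hper : Function.Periodic (c z) T := fun t => Subtype.ext (z.2.2 t)
  have hK : IsCompact (range (c z)) :=
    hper.compact_of_continuous hT ((continuous_tripleCurve z.1).subtype_mk _)
  have hunif := hK.uniformContinuousAt_of_continuousAt (S.domRestrict G)
    (fun _ _ => hG.domRestrict.continuousAt) (Metric.dist_mem_uniformity (half_pos hε))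
  obtain ⟨δ, hδ, h⟩ := Metric.mem_uniformity_dist.1 hunif
  filter_upwards [Metric.ball_mem_nhds z hδ] with w hw
  refine lt_of_le_of_lt ((dist_le (half_pos hε).le).2 fun t => ?_) (half_lt_self hε)
  have hd : dist (c z t) (c w t) < δ :=
    (dist_tripleCurve_le z.1 w.1 t).trans_lt (by rw [dist_comm]; exact hw)
  rw [dist_comm]
  exact (h hd (mem_range_self t)).le

end Superposition

section ForcedPairs

variable {n : ℕ} {U : Set (EuclideanSpace ℝ (Fin n))}
  {φ ψ : ℝ → EuclideanSpace ℝ (Fin n) → EuclideanSpace ℝ (Fin n) → EuclideanSpace ℝ (Fin n)}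
  {g : EuclideanSpace ℝ (Fin n) → EuclideanSpace ℝ (Fin n) → EuclideanSpace ℝ (Fin n)}
  {T : ℝ}
  {f : ℝ → EuclideanSpace ℝ (Fin n) → EuclideanSpace ℝ (Fin n) → ℝ → EuclideanSpace ℝ (Fin n)}

theorem tripleSet_subset_periodicTriples :
    TripleSet n U ψ g T f ⊆ periodicTriples (Ici 0 ×ˢ U ×ˢ univ) T := by
  rintro z ⟨h0, hU, hx, hy, -, -⟩
  exact ⟨fun t => ⟨h0, hU t, mem_univ _⟩, fun t => by simp only [tripleCurve, hx, hy]⟩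

theorem forcedSet_subset_periodicTriples :
    ForcedSet n U φ g T f ⊆ periodicTriples (Ici 0 ×ˢ U ×ˢ univ) T := by
  rintro z ⟨h0, hU, hx, hy, -, -⟩
  exact ⟨fun t => ⟨h0, hU t, mem_univ _⟩, fun t => by simp only [tripleCurve, hx, hy]⟩

theorem TripleSet.hasDerivAt
    (hψcont : ContinuousOn
      (fun z : ℝ × EuclideanSpace ℝ (Fin n) × EuclideanSpace ℝ (Fin n) => ψ z.1 z.2.1 z.2.2)
      (Ici 0 ×ˢ U ×ˢ univ))
    {z : ℝ × (ℝ →ᵇ EuclideanSpace ℝ (Fin n)) × (ℝ →ᵇ EuclideanSpace ℝ (Fin n))}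
    (hz : z ∈ TripleSet n U ψ g T f) (t : ℝ) :
    HasDerivAt z.2.1 (ψ z.1 (z.2.1 t) (z.2.2 t)) t := by
  have hc : Continuous fun s => ψ z.1 (z.2.1 s) (z.2.2 s) :=
    continuous_comp_tripleCurve hψcont (tripleSet_subset_periodicTriples hz)
  have hd := (hc.integral_hasStrictDerivAt 0 t).hasDerivAt.const_add (z.2.1 0)
  exact hd.congr_of_eventuallyEq (.of_forall hz.2.2.2.2.1)

/-- `T`-triples of the first-order system correspond to `T`-forced pairs through
`x' = ψ (λ, x, y)` and `y = φ (λ, x, x')`. -/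
noncomputable def tripleHomeomorphForced
    (hφcont : ContinuousOn
      (fun z : ℝ × EuclideanSpace ℝ (Fin n) × EuclideanSpace ℝ (Fin n) => φ z.1 z.2.1 z.2.2)
      (Ici 0 ×ˢ U ×ˢ univ))
    (hφψ : ∀ lam ∈ Ici (0 : ℝ), ∀ p ∈ U, ∀ u, φ lam p (ψ lam p u) = u)
    (hψφ : ∀ lam ∈ Ici (0 : ℝ), ∀ p ∈ U, ∀ q, ψ lam p (φ lam p q) = q)
    (hψcont : ContinuousOn
      (fun z : ℝ × EuclideanSpace ℝ (Fin n) × EuclideanSpace ℝ (Fin n) => ψ z.1 z.2.1 z.2.2)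
      (Ici 0 ×ˢ U ×ˢ univ))
    (hT : T ≠ 0) :
    TripleSet n U ψ g T f ≃ₜ ForcedSet n U φ g T f where
  toFun z := ⟨(z.1.1, z.1.2.1, superposition hT _ hψcont
      (inclusion tripleSet_subset_periodicTriples z)), by
    obtain ⟨z, hz⟩ := z
    have hd := TripleSet.hasDerivAt hψcont hz
    obtain ⟨h0, hU, hx, hy, -, hyint⟩ := hz
    refine ⟨h0, hU, hx, fun t => ?_, hd, fun t => ?_⟩
    · simp only [superposition_apply, tripleCurve, hx, hy]
    · simp only [superposition_apply, tripleCurve]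
      rw [hφψ _ h0 _ (hU _), hφψ _ h0 _ (hU _)]
      exact hyint t⟩
  invFun w := ⟨(w.1.1, w.1.2.1, superposition hT _ hφcont
      (inclusion forcedSet_subset_periodicTriples w)), by
    obtain ⟨w, h0, hU, hx, hy, hd, hyint⟩ := w
    refine ⟨h0, hU, hx, fun t => ?_, fun t => ?_, fun t => ?_⟩
    · simp only [superposition_apply, tripleCurve, hx, hy]
    · simp only [superposition_apply, tripleCurve]
      simp_rw [fun s => hψφ _ h0 _ (hU s)]
      rw [integral_eq_sub_of_hasDerivAt (fun s _ => hd s)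
        (w.2.2.continuous.intervalIntegrable 0 t), add_sub_cancel]
    · simp only [superposition_apply, tripleCurve]
      simp_rw [fun s => hψφ _ h0 _ (hU s)]
      exact hyint t⟩
  left_inv z := by
    refine Subtype.ext (Prod.ext rfl (Prod.ext rfl (BoundedContinuousFunction.ext fun t => ?_)))
    exact hφψ _ z.2.1 _ (z.2.2.1 t) _
  right_inv w := by
    refine Subtype.ext (Prod.ext rfl (Prod.ext rfl (BoundedContinuousFunction.ext fun t => ?_)))
    exact hψφ _ w.2.1 _ (w.2.2.1 t) _
  continuous_toFun := by
    have := (continuous_superposition hT hψcont).comp (continuous_inclusion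
      (tripleSet_subset_periodicTriples (n := n) (U := U) (ψ := ψ) (g := g) (T := T) (f := f)))
    exact (continuous_subtype_val.fst.prodMk
      (continuous_subtype_val.snd.fst.prodMk this)).subtype_mk _
  continuous_invFun := by
    have := (continuous_superposition hT hφcont).comp (continuous_inclusion
      (forcedSet_subset_periodicTriples (n := n) (U := U) (φ := φ) (g := g) (T := T) (f := f)))
    exact (continuous_subtype_val.fst.prodMk
      (continuous_subtype_val.snd.fst.prodMk this)).subtype_mk _

end ForcedPairs

/-- Lemma 5.1: the map `𝔥 : (λ,x,y) ↦ (λ,x)` is a homeomorphism from the set of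
`T`-triples of the equivalent system onto the set of `T`-forced pairs of
`[φ(λ,x,x')]' = g(x,x') + λ f(t,x,x',λ)` (with the `C¹` topology on the latter), its inverse being
`(λ,x) ↦ (λ,x,φ(λ,x,x'))`, and it respects triviality. -/
theorem stmt_7 (n : ℕ) (hn : 1 ≤ n)
    (U : Set (EuclideanSpace ℝ (Fin n))) (hU : IsOpen U)
    (φ ψ : ℝ → EuclideanSpace ℝ (Fin n) → EuclideanSpace ℝ (Fin n) →
      EuclideanSpace ℝ (Fin n))
    (hφcont : ContinuousOn
      (fun z : ℝ × EuclideanSpace ℝ (Fin n) × EuclideanSpace ℝ (Fin n) =>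
        φ z.1 z.2.1 z.2.2)
      (Set.Ici 0 ×ˢ U ×ˢ Set.univ))
    (hφbij : ∀ lam ∈ Set.Ici (0:ℝ), ∀ p ∈ U, Function.Bijective (φ lam p))
    (hψspec : ∀ lam ∈ Set.Ici (0:ℝ), ∀ p ∈ U, ∀ u : EuclideanSpace ℝ (Fin n),
      φ lam p (ψ lam p u) = u)
    (hψcont : ContinuousOn
      (fun z : ℝ × EuclideanSpace ℝ (Fin n) × EuclideanSpace ℝ (Fin n) =>
        ψ z.1 z.2.1 z.2.2)
      (Set.Ici 0 ×ˢ U ×ˢ Set.univ))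
    (g : EuclideanSpace ℝ (Fin n) → EuclideanSpace ℝ (Fin n) →
      EuclideanSpace ℝ (Fin n))
    (hgcont : ContinuousOn
      (fun z : EuclideanSpace ℝ (Fin n) × EuclideanSpace ℝ (Fin n) =>
        g z.1 z.2)
      (U ×ˢ Set.univ))
    (T : ℝ) (hT : 0 < T)
    (f : ℝ → EuclideanSpace ℝ (Fin n) → EuclideanSpace ℝ (Fin n) → ℝ →
      EuclideanSpace ℝ (Fin n))
    (hf : TPeriodicCaratheodory n U T f) :
    ∃ H : (TripleSet n U ψ g T f) ≃ₜ (ForcedSet n U φ g T f),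
      -- `𝔥(λ,x,y) = (λ,x)`
      (∀ z : TripleSet n U ψ g T f,
        (H z).1.1 = z.1.1 ∧ (H z).1.2.1 = z.1.2.1) ∧
      -- the inverse is `(λ,x) ↦ (λ, x, φ(λ, x(·), x'(·)))`
      (∀ w : ForcedSet n U φ g T f, ∀ t : ℝ,
        (H.symm w).1.2.2 t = φ w.1.1 (w.1.2.1 t) (w.1.2.2 t)) ∧
      -- `𝔥` respects triviality
      (∀ z : TripleSet n U ψ g T f,
        (z.1.1 = 0 ∧ (∀ t : ℝ, z.1.2.1 t = z.1.2.1 0) ∧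
          (∀ t : ℝ, z.1.2.2 t = z.1.2.2 0)) ↔
        ((H z).1.1 = 0 ∧ ∀ t : ℝ, (H z).1.2.1 t = (H z).1.2.1 0)) := by
  have hψφ : ∀ lam ∈ Ici (0 : ℝ), ∀ p ∈ U, ∀ q, ψ lam p (φ lam p q) = q :=
    fun lam hl p hp q => (hφbij lam hl p hp).1 (hψspec lam hl p hp _)
  refine ⟨tripleHomeomorphForced hφcont hψspec hψφ hψcont hT.ne', fun z => ⟨rfl, rfl⟩,
    fun w t => rfl, fun z => ⟨fun h => ⟨h.1, h.2.1⟩, ?_⟩⟩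
  rintro ⟨h0, hx : ∀ t, z.1.2.1 t = z.1.2.1 0⟩
  refine ⟨h0, hx, ?_⟩
  have hψ : ∀ t, ψ z.1.1 (z.1.2.1 t) (z.1.2.2 t) = 0 := fun t =>
    (TripleSet.hasDerivAt hψcont z.2 t).unique
      ((hasDerivAt_const t (z.1.2.1 0)).congr_of_eventuallyEq (.of_forall hx))
  have hy : ∀ t, z.1.2.2 t = φ z.1.1 (z.1.2.1 0) 0 := fun t => by
    rw [← hψspec _ z.2.1 _ (z.2.2.1 t) (z.1.2.2 t), hψ, hx]
  exact fun t => (hy t).trans (hy 0).symm
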